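/- arXiv:1908.05173 — 2 statements merged into one kernel-verified Lean document; each statement's English description precedes it below -/
import Mathlib

section
/- Let f and g each belong to the following family of polynomials in ℝ[x,y]: x³ − y² + ε·x + J with ε ∈ {1, −1} and J ∈ ℝ; x³ − y² + ε with ε ∈ {1, −1}; x³ − y²; x³ − y; x³ − x·y + 1; x³ − x·y; x³ + ε·x + J with ε ∈ {1, −1} and J ≥ 0; x³ + 1; x³. If f ≈ g, then f = g. -/
open MvPolynomial

/-- The polynomial ring `ℝ[x,y]`, realized as `MvPolynomial (Fin 2) ℝ`
with `X 0 = x` and `X 1 = y`. -/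
abbrev P2 : Type := MvPolynomial (Fin 2) ℝ

/-- `f ∼ g` : there are an affine automorphism `θ ∈ Γ₂(ℝ)` (a ring automorphism
of `ℝ[x,y]` sending `x` and `y` to polynomials of total degree at most 1)
and a nonzero `c ∈ ℝ` with `θ f = c • g`. -/
def AffEquiv (f g : P2) : Prop :=
  ∃ θ : P2 ≃+* P2, (θ (X 0)).totalDegree ≤ 1 ∧ (θ (X 1)).totalDegree ≤ 1 ∧
    ∃ c : ℝ, c ≠ 0 ∧ θ f = C c * g

/-- `f ≈ g` : there are a ring automorphism `φ` of `ℝ[x,y]` and a nonzero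
`c ∈ ℝ` with `φ f = c • g`. -/
def AutEquiv (f g : P2) : Prop :=
  ∃ φ : P2 ≃+* P2, ∃ c : ℝ, c ≠ 0 ∧ φ f = C c * g

/-- The table entries with canonical form `x³`. -/
def FamD (p : P2) : Prop :=
  (∃ e J : ℝ, (e = 1 ∨ e = -1) ∧
    p = X 0 ^ 3 - X 1 ^ 2 + C e * X 0 + C J) ∨
  (∃ e : ℝ, (e = 1 ∨ e = -1) ∧ p = X 0 ^ 3 - X 1 ^ 2 + C e) ∨
  p = X 0 ^ 3 - X 1 ^ 2 ∨
  p = X 0 ^ 3 - X 1 ∨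
  p = X 0 ^ 3 - X 0 * X 1 + 1 ∨
  p = X 0 ^ 3 - X 0 * X 1 ∨
  (∃ e J : ℝ, (e = 1 ∨ e = -1) ∧ 0 ≤ J ∧ p = X 0 ^ 3 + C e * X 0 + C J) ∨
  p = X 0 ^ 3 + 1 ∨
  p = X 0 ^ 3

/-- Every ring automorphism of `ℝ[x,y]` fixes the constants. -/
theorem P2.ringEquiv_C (φ : P2 ≃+* P2) (r : ℝ) : φ (C r) = C r := by
  have hconst : ∀ r : ℝ, ∃ s : ℝ, φ (C r) = C s := by
    intro r
    rcases eq_or_ne r 0 with rfl | hr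
    · exact ⟨0, by simp⟩
    · have hu : IsUnit (φ (C r)) := ((isUnit_iff_ne_zero.mpr hr).map C).map φ
      obtain ⟨s, -, hs⟩ := isUnit_iff_eq_C_of_isReduced.mp hu
      exact ⟨s, hs⟩
  have hid : (constantCoeff.comp ((φ : P2 →+* P2).comp C) : ℝ →+* ℝ) = RingHom.id ℝ :=
    Subsingleton.elim _ _
  obtain ⟨s, hs⟩ := hconst r
  have hsr : s = r := by
    have hr := RingHom.congr_fun hid r
    rwa [RingHom.comp_apply, RingHom.comp_apply, RingHom.coe_coe, hs, constantCoeff_C,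
      RingHom.id_apply] at hr
  rw [hs, hsr]

theorem AutEquiv.symm {f g : P2} (h : AutEquiv f g) : AutEquiv g f := by
  obtain ⟨φ, c, hc, h⟩ := h
  refine ⟨φ.symm, c⁻¹, inv_ne_zero hc, ?_⟩
  have hf : f = C c * φ.symm g := by
    rw [← P2.ringEquiv_C φ.symm c, ← map_mul, ← h, RingEquiv.symm_apply_apply]
  rw [hf, ← mul_assoc, ← C_mul, inv_mul_cancel₀ hc, C_1, one_mul]

/-- The chain rule for partial derivatives under a ring automorphism of `ℝ[x,y]`. -/
theorem P2.pderiv_ringEquiv (φ : P2 ≃+* P2) (i : Fin 2) (f : P2) :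
    pderiv i (φ f) =
      φ (pderiv 0 f) * pderiv i (φ (X 0)) + φ (pderiv 1 f) * pderiv i (φ (X 1)) := by
  induction f using MvPolynomial.induction_on with
  | C r => simp [P2.ringEquiv_C]
  | add p q hp hq => simp only [map_add, hp, hq]; ring
  | mul_X p j hp =>
    fin_cases j <;> simp [hp, pderiv_X] <;> ring

/-- The Jacobian determinant of a ring automorphism of `ℝ[x,y]`. -/
noncomputable def P2.jacobian (φ : P2 ≃+* P2) : P2 :=
  pderiv 0 (φ (X 0)) * pderiv 1 (φ (X 1)) - pderiv 1 (φ (X 0)) * pderiv 0 (φ (X 1))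

theorem P2.exists_jacobian_eq_C (φ : P2 ≃+* P2) : ∃ d : ℝ, d ≠ 0 ∧ P2.jacobian φ = C d := by
  have hmul : P2.jacobian φ * φ (P2.jacobian φ.symm) = 1 := by
    have h00 := P2.pderiv_ringEquiv φ 0 (φ.symm (X 0))
    have h01 := P2.pderiv_ringEquiv φ 0 (φ.symm (X 1))
    have h10 := P2.pderiv_ringEquiv φ 1 (φ.symm (X 0))
    have h11 := P2.pderiv_ringEquiv φ 1 (φ.symm (X 1))
    simp only [RingEquiv.apply_symm_apply, pderiv_X, Pi.single_apply] at h00 h01 h10 h11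
    norm_num at h00 h01 h10 h11
    simp only [P2.jacobian, map_sub, map_mul]
    linear_combination (-1 : P2) * h00 - h11 *
      (φ (pderiv 0 (φ.symm (X 0))) * pderiv 0 (φ (X 0)) +
        φ (pderiv 1 (φ.symm (X 0))) * pderiv 0 (φ (X 1))) + h01 *
      (φ (pderiv 0 (φ.symm (X 0))) * pderiv 1 (φ (X 0)) +
        φ (pderiv 1 (φ.symm (X 0))) * pderiv 1 (φ (X 1)))
  obtain ⟨d, hd, h⟩ := isUnit_iff_eq_C_of_isReduced.mp (IsUnit.of_mul_eq_one _ hmul)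
  exact ⟨d, hd.ne_zero, h⟩

section CriticalPoints

variable {K : Type*} [Field K] [Algebra ℝ K]

/-- `p` is a critical point of `f`. -/
def P2.IsCrit (f : P2) (p : Fin 2 → K) : Prop :=
  aeval p (pderiv 0 f) = 0 ∧ aeval p (pderiv 1 f) = 0

/-- The value at `p` of the second partial derivative of `f` in the directions `i` and `j`. -/
noncomputable def P2.hess (f : P2) (p : Fin 2 → K) (i j : Fin 2) : K :=
  aeval p (pderiv i (pderiv j f))

/-- The Hessian determinant of `f` at `p`. -/
noncomputable def P2.hessDet (f : P2) (p : Fin 2 → K) : K :=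
  P2.hess f p 0 0 * P2.hess f p 1 1 - P2.hess f p 0 1 ^ 2

end CriticalPoints

theorem P2.hess_comm {K : Type*} [Field K] [Algebra ℝ K] (f : P2) (p : Fin 2 → K) :
    P2.hess f p 1 0 = P2.hess f p 0 1 := by
  have h : ⁅pderiv (R := ℝ) (1 : Fin 2), pderiv (R := ℝ) (0 : Fin 2)⁆ = 0 :=
    derivation_ext fun i => by
      fin_cases i <;> simp [Derivation.commutator_apply, pderiv_X]
  have hf := congrArg (aeval p) (DFunLike.congr_fun h f)
  rw [Derivation.commutator_apply, map_sub, Derivation.zero_apply, map_zero, sub_eq_zero] at hf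
  exact hf

/-- Critical points, critical values and Hessians transform along `≈`. -/
theorem AutEquiv.exists_transfer {f g : P2} (h : AutEquiv f g) :
    ∃ c d : ℝ, c ≠ 0 ∧ d ≠ 0 ∧ ∀ {K : Type} [Field K] [Algebra ℝ K] (p : Fin 2 → K),
      P2.IsCrit g p → ∃ q : Fin 2 → K, ∃ α β : K, P2.IsCrit f q ∧
        aeval q f = algebraMap ℝ K c * aeval p g ∧
        algebraMap ℝ K c ^ 2 * P2.hessDet g p = algebraMap ℝ K d ^ 2 * P2.hessDet f q ∧
        algebraMap ℝ K c * P2.hess g p 1 1 =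
          P2.hess f q 0 0 * α ^ 2 + 2 * P2.hess f q 0 1 * α * β + P2.hess f q 1 1 * β ^ 2 := by
  obtain ⟨φ, c, hc, h⟩ := h
  obtain ⟨d, hd, hJ⟩ := P2.exists_jacobian_eq_C φ
  refine ⟨c, d, hc, hd, fun {K} _ _ p hp => ?_⟩
  obtain ⟨hp0, hp1⟩ := hp
  set q : Fin 2 → K := fun i => aeval p (φ (X i)) with hq
  have hev : ∀ u : P2, aeval p (φ u) = aeval q u := by
    intro u
    induction u using MvPolynomial.induction_on with
    | C r => simp [P2.ringEquiv_C]
    | add u v hu hv => simp [hu, hv]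
    | mul_X u j hu => simp [hu, hq]
  have hJ' := congrArg (aeval p) hJ
  simp only [P2.jacobian, map_sub, map_mul, aeval_C] at hJ'
  have hd' : algebraMap ℝ K d ≠ 0 := by simpa using hd
  have hgrad : ∀ i, algebraMap ℝ K c * aeval p (pderiv i g) =
      aeval q (pderiv 0 f) * aeval p (pderiv i (φ (X 0))) +
        aeval q (pderiv 1 f) * aeval p (pderiv i (φ (X 1))) := by
    intro i
    have := congrArg (fun u => aeval p (pderiv i u)) h
    simp only [P2.pderiv_ringEquiv φ i f, pderiv_C_mul, map_add, map_mul, hev, aeval_C] at this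
    exact this.symm
  have hg0 := hgrad 0
  have hg1 := hgrad 1
  rw [hp0, mul_zero] at hg0
  rw [hp1, mul_zero] at hg1
  have hf0 : aeval q (pderiv 0 f) = 0 := by
    refine (mul_eq_zero.mp (?_ : algebraMap ℝ K d * _ = 0)).resolve_left hd'
    linear_combination (-aeval q (pderiv 0 f)) * hJ' - aeval p (pderiv 1 (φ (X 1))) * hg0 +
      aeval p (pderiv 0 (φ (X 1))) * hg1
  have hf1 : aeval q (pderiv 1 f) = 0 := by
    refine (mul_eq_zero.mp (?_ : algebraMap ℝ K d * _ = 0)).resolve_left hd'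
    linear_combination (-aeval q (pderiv 1 f)) * hJ' + aeval p (pderiv 1 (φ (X 0))) * hg0 -
      aeval p (pderiv 0 (φ (X 0))) * hg1
  have hhess : ∀ i j, algebraMap ℝ K c * P2.hess g p i j =
      (P2.hess f q 0 0 * aeval p (pderiv i (φ (X 0))) +
        P2.hess f q 0 1 * aeval p (pderiv i (φ (X 1)))) * aeval p (pderiv j (φ (X 0))) +
      (P2.hess f q 0 1 * aeval p (pderiv i (φ (X 0))) +
        P2.hess f q 1 1 * aeval p (pderiv i (φ (X 1)))) * aeval p (pderiv j (φ (X 1))) := by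
    intro i j
    have hij := congrArg (fun u => aeval p (pderiv i (pderiv j u))) h
    simp only [P2.pderiv_ringEquiv φ _ f, map_add, map_mul, hev, aeval_C, pderiv_C, map_zero,
      pderiv_mul, P2.pderiv_ringEquiv φ _ (pderiv 0 f), P2.pderiv_ringEquiv φ _ (pderiv 1 f),
      hf0, hf1] at hij
    have hcomm := P2.hess_comm f q
    simp only [P2.hess] at hcomm ⊢
    rw [hcomm] at hij
    linear_combination -hij
  refine ⟨q, aeval p (pderiv 1 (φ (X 0))), aeval p (pderiv 1 (φ (X 1))), ⟨hf0, hf1⟩, ?_, ?_, ?_⟩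
  · rw [← hev, h, map_mul, aeval_C]
  · have h00 := hhess 0 0
    have h01 := hhess 0 1
    have h11 := hhess 1 1
    rw [← hJ']
    simp only [P2.hessDet]
    calc _ = (algebraMap ℝ K c * P2.hess g p 0 0) * (algebraMap ℝ K c * P2.hess g p 1 1) -
          (algebraMap ℝ K c * P2.hess g p 0 1) ^ 2 := by ring
      _ = _ := by rw [h00, h01, h11]; ring
  · rw [hhess]; ring

/-- The cubics `x³ - δy² + ax + b`. -/
noncomputable def P2.cubic (δ a b : ℝ) : P2 :=
  X 0 ^ 3 - C δ * X 1 ^ 2 + C a * X 0 + C b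

/-- The cubics `x³ - xy + b`. -/
noncomputable def P2.saddle (b : ℝ) : P2 := X 0 ^ 3 - X 0 * X 1 + C b

section NormalForms

variable {K : Type*} [Field K] [Algebra ℝ K]

theorem P2.aeval_cubic (δ a b : ℝ) (p : Fin 2 → K) :
    aeval p (P2.cubic δ a b) =
      p 0 ^ 3 - algebraMap ℝ K δ * p 1 ^ 2 + algebraMap ℝ K a * p 0 + algebraMap ℝ K b := by
  simp [P2.cubic]

theorem P2.isCrit_cubic_iff (δ a b : ℝ) (p : Fin 2 → K) :
    P2.IsCrit (P2.cubic δ a b) p ↔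
      3 * p 0 ^ 2 + algebraMap ℝ K a = 0 ∧ algebraMap ℝ K δ * p 1 = 0 := by
  have : CharZero K := charZero_of_injective_algebraMap (algebraMap ℝ K).injective
  simp [P2.IsCrit, P2.cubic, pderiv_X]

theorem P2.hess_cubic (δ a b : ℝ) (p : Fin 2 → K) :
    P2.hess (P2.cubic δ a b) p 0 0 = 6 * p 0 ∧ P2.hess (P2.cubic δ a b) p 0 1 = 0 ∧
      P2.hess (P2.cubic δ a b) p 1 1 = -2 * algebraMap ℝ K δ := by
  have hnum (i : Fin 2) (n : ℕ) [n.AtLeastTwo] : pderiv i (OfNat.ofNat n : P2) = 0 := by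
    exact_mod_cast (pderiv (R := ℝ) i).map_natCast n
  refine ⟨?_, ?_, ?_⟩ <;> simp [P2.hess, P2.cubic, pderiv_X, hnum]
  all_goals ring

theorem P2.hessDet_cubic (δ a b : ℝ) (p : Fin 2 → K) :
    P2.hessDet (P2.cubic δ a b) p = -12 * algebraMap ℝ K δ * p 0 := by
  obtain ⟨h00, h01, h11⟩ := P2.hess_cubic δ a b p
  rw [P2.hessDet, h00, h01, h11]
  ring

theorem P2.aeval_saddle (b : ℝ) (p : Fin 2 → K) :
    aeval p (P2.saddle b) = p 0 ^ 3 - p 0 * p 1 + algebraMap ℝ K b := by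
  simp [P2.saddle]

theorem P2.isCrit_saddle_iff (b : ℝ) (p : Fin 2 → K) :
    P2.IsCrit (P2.saddle b) p ↔ p 0 = 0 ∧ p 1 = 0 := by
  simp only [P2.IsCrit, P2.saddle, map_add, map_sub, Derivation.leibniz, Derivation.leibniz_pow,
    pderiv_C, pderiv_X]
  simp
  grind

theorem P2.hessDet_saddle (b : ℝ) (p : Fin 2 → K) : P2.hessDet (P2.saddle b) p = -1 := by
  simp [P2.hessDet, P2.hess, P2.saddle, pderiv_X]

theorem P2.not_isCrit_X_pow_sub_X (p : Fin 2 → K) : ¬ P2.IsCrit (X 0 ^ 3 - X 1 : P2) p := by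
  simp [P2.IsCrit, pderiv_X]

end NormalForms

/-- Over `ℂ` the cubics have critical points symmetric with respect to the `y`-axis. -/
theorem P2.exists_isCrit_cubic (δ a b : ℝ) : ∃ s : ℂ, 3 * s ^ 2 + a = 0 ∧
    P2.IsCrit (P2.cubic δ a b) ![s, 0] ∧ P2.IsCrit (P2.cubic δ a b) ![-s, 0] := by
  obtain ⟨s, hs⟩ := IsAlgClosed.exists_pow_nat_eq (-(a : ℂ) / 3) (n := 2) (by norm_num)
  have hs' : 3 * s ^ 2 + (a : ℂ) = 0 := by rw [hs]; ring
  refine ⟨s, hs', ?_, ?_⟩ <;> simp [P2.isCrit_cubic_iff, hs']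

theorem P2.not_autEquiv_saddle_cubic (b δ a' b' : ℝ) :
    ¬ AutEquiv (P2.saddle b) (P2.cubic δ a' b') := by
  intro h
  obtain ⟨c, d, -, hd, h⟩ := h.exists_transfer
  obtain ⟨s, -, hp, hm⟩ := P2.exists_isCrit_cubic δ a' b'
  obtain ⟨q, -, -, -, -, hq, -⟩ := h _ hp
  obtain ⟨r, -, -, -, -, hr, -⟩ := h _ hm
  simp only [P2.hessDet_cubic, P2.hessDet_saddle, Complex.coe_algebraMap,
    Matrix.cons_val_zero] at hq hr
  have hd2 : (d : ℂ) ^ 2 = 0 := by linear_combination (1 / 2 : ℂ) * hq + 1 / 2 * hr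
  exact hd (by exact_mod_cast pow_eq_zero_iff two_ne_zero |>.mp hd2)

theorem P2.autEquiv_saddle_saddle {b b' : ℝ} (h : AutEquiv (P2.saddle b) (P2.saddle b')) :
    ∃ c : ℝ, c ≠ 0 ∧ b = c * b' := by
  obtain ⟨c, d, hc, -, h⟩ := h.exists_transfer
  obtain ⟨q, -, -, hq, hv, -⟩ := h (K := ℝ) 0 ((P2.isCrit_saddle_iff b' _).mpr ⟨rfl, rfl⟩)
  rw [P2.isCrit_saddle_iff] at hq
  refine ⟨c, hc, ?_⟩
  rw [P2.aeval_saddle, P2.aeval_saddle] at hv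
  simpa [hq.1] using hv

/-- The nondegenerate case: two distinct critical values over `ℂ`. -/
theorem P2.autEquiv_cubic_of_ne_zero {δ a b δ' a' b' : ℝ}
    (h : AutEquiv (P2.cubic δ a b) (P2.cubic δ' a' b')) (ha' : a' ≠ 0) :
    a ≠ 0 ∧ ∃ c d : ℝ, c ≠ 0 ∧ d ≠ 0 ∧ b = c * b' ∧ a ^ 3 = c ^ 2 * a' ^ 3 ∧
      c * δ' * a = d ^ 2 * δ * a' := by
  obtain ⟨c, d, hc, hd, h⟩ := h.exists_transfer
  obtain ⟨s, hs, hp, hm⟩ := P2.exists_isCrit_cubic δ' a' b'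
  obtain ⟨q, -, -, hqc, hqv, hqh, -⟩ := h _ hp
  obtain ⟨r, -, -, hrc, hrv, -, -⟩ := h _ hm
  rw [P2.isCrit_cubic_iff] at hqc hrc
  simp only [P2.hessDet_cubic, P2.aeval_cubic, Complex.coe_algebraMap, Matrix.cons_val_zero,
    Matrix.cons_val_one] at hqc hqv hqh hrc hrv
  have hcC : (c : ℂ) ≠ 0 := by exact_mod_cast hc
  have haC : (a' : ℂ) ≠ 0 := by exact_mod_cast ha'
  have hs0 : s ≠ 0 := by
    rintro rfl
    exact haC (by simpa using hs)
  have hqv' : 2 / 3 * a * q 0 + b = c * (2 / 3 * a' * s + b') := by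
    linear_combination hqv - q 0 / 3 * hqc.1 + q 1 * hqc.2 + c * s / 3 * hs
  have hrv' : 2 / 3 * a * r 0 + b = c * (-(2 / 3 * a' * s) + b') := by
    linear_combination hrv - r 0 / 3 * hrc.1 + r 1 * hrc.2 - c * s / 3 * hs
  have hne : q 0 - r 0 ≠ 0 := by
    intro h0
    have : (c : ℂ) * a' * s = 0 := by
      linear_combination (-3 / 4 : ℂ) * hqv' + 3 / 4 * hrv' + a / 2 * h0
    exact mul_ne_zero (mul_ne_zero hcC haC) hs0 this
  have hsum : q 0 + r 0 = 0 := by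
    refine (mul_eq_zero.mp (?_ : (q 0 - r 0) * _ = 0)).resolve_left hne
    linear_combination (1 / 3 : ℂ) * hqc.1 - 1 / 3 * hrc.1
  have hlin : (a : ℂ) * q 0 = c * a' * s := by
    linear_combination (3 / 4 : ℂ) * hqv' - 3 / 4 * hrv' + a / 2 * hsum
  refine ⟨?_, c, d, hc, hd, ?_, ?_, ?_⟩
  · rintro rfl
    exact mul_ne_zero (mul_ne_zero hcC haC) hs0 (by simpa using hlin.symm)
  · have : (b : ℂ) = c * b' := by linear_combination hqv' - 2 / 3 * hlin
    exact_mod_cast this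
  · have : (a : ℂ) ^ 3 = c ^ 2 * a' ^ 3 := by
      linear_combination (a : ℂ) ^ 2 * hqc.1 - 3 * (a * q 0 + c * a' * s) * hlin -
        c ^ 2 * a' ^ 2 * hs
    exact_mod_cast this
  · have : (c : ℂ) * δ' * a = d ^ 2 * δ * a' := by
      refine mul_left_cancel₀ (mul_ne_zero hcC hs0) ?_
      linear_combination (-1 / 12 * a : ℂ) * hqh + d ^ 2 * δ * hlin
    exact_mod_cast this

/-- The degenerate case: a single critical value. -/
theorem P2.autEquiv_cubic_zero {δ b δ' b' : ℝ}
    (h : AutEquiv (P2.cubic δ 0 b) (P2.cubic δ' 0 b')) :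
    ∃ c β : ℝ, c ≠ 0 ∧ b = c * b' ∧ c * δ' = δ * β ^ 2 := by
  obtain ⟨c, d, hc, -, h⟩ := h.exists_transfer
  obtain ⟨q, α, β, hqc, hqv, -, hqh⟩ :=
    h (K := ℝ) 0 ((P2.isCrit_cubic_iff δ' 0 b' _).mpr (by simp))
  obtain ⟨h00, h01, h11⟩ := P2.hess_cubic δ 0 b q
  rw [h00, h01, h11, (P2.hess_cubic δ' 0 b' _).2.2] at hqh
  rw [P2.isCrit_cubic_iff] at hqc
  simp only [P2.aeval_cubic, Algebra.algebraMap_self, RingHom.id_apply, Pi.zero_apply]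
    at hqc hqv hqh
  have hq0 : q 0 = 0 := by simpa using hqc.1
  rw [hq0] at hqv hqh
  exact ⟨c, β, hc, by linear_combination hqv + q 1 * hqc.2, by linear_combination (-1 / 2) * hqh⟩

theorem P2.cubic_eq_of_autEquiv {δ a b δ' a' b' : ℝ}
    (hδ : δ = 0 ∨ δ = 1) (hδ' : δ' = 0 ∨ δ' = 1)
    (ha : a = 0 ∨ a = 1 ∨ a = -1) (ha' : a' = 0 ∨ a' = 1 ∨ a' = -1)
    (hb : a = 0 → b = 0 ∨ b = 1 ∨ b = -1) (hb' : a' = 0 → b' = 0 ∨ b' = 1 ∨ b' = -1)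
    (hpos : δ = 0 → 0 ≤ b) (hpos' : δ' = 0 → 0 ≤ b')
    (h : AutEquiv (P2.cubic δ a b) (P2.cubic δ' a' b')) :
    P2.cubic δ a b = P2.cubic δ' a' b' := by
  suffices δ = δ' ∧ a = a' ∧ b = b' by
    obtain ⟨rfl, rfl, rfl⟩ := this
    rfl
  by_cases h0 : a' = 0
  · have h0' : a = 0 := by
      by_contra hne
      exact (P2.autEquiv_cubic_of_ne_zero h.symm hne).1 h0
    subst h0 h0'
    obtain ⟨c, β, hc, hbb, hcd⟩ := P2.autEquiv_cubic_zero h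
    obtain ⟨c₁, β₁, hc₁, -, hcd₁⟩ := P2.autEquiv_cubic_zero h.symm
    have hb := hb rfl
    have hb' := hb' rfl
    have hδδ : δ = δ' := by
      rcases hδ with rfl | rfl <;> rcases hδ' with rfl | rfl
      · rfl
      · exact absurd (by simpa using hcd) hc
      · exact absurd (by simpa using hcd₁) hc₁
      · rfl
    subst hδδ
    refine ⟨rfl, rfl, ?_⟩
    rcases hδ with rfl | rfl
    · have := hpos rfl
      have := hpos' rfl
      rcases hb with rfl | rfl | rfl <;> rcases hb' with rfl | rfl | rfl <;>
        first | rfl | (exfalso; linarith) | simp_all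
    · have hcpos : 0 ≤ c := by nlinarith [sq_nonneg β]
      rcases hb with rfl | rfl | rfl <;> rcases hb' with rfl | rfl | rfl <;>
        first | rfl | (exfalso; linarith) | simp_all
  · obtain ⟨h0', c, d, hc, hd, hbb, haa, hcd⟩ := P2.autEquiv_cubic_of_ne_zero h h0
    have hd2 : 0 < d ^ 2 := by positivity
    have haa' : a = a' ∧ c ^ 2 = 1 := by
      have := sq_nonneg c
      rcases ha.resolve_left h0' with rfl | rfl <;> rcases ha'.resolve_left h0 with rfl | rfl <;>
        refine ⟨?_, ?_⟩ <;> linarith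
    obtain ⟨rfl, hc2⟩ := haa'
    have hcd' : c * δ' = d ^ 2 * δ := mul_right_cancel₀ h0 hcd
    have hδδ : δ = δ' := by
      rcases hδ with rfl | rfl <;> rcases hδ' with rfl | rfl <;> simp_all
    subst hδδ
    refine ⟨rfl, rfl, ?_⟩
    rcases mul_self_eq_one_iff.mp (pow_two c ▸ hc2) with rfl | rfl
    · linarith
    · rcases hδ with rfl | rfl
      · have := hpos rfl
        have := hpos' rfl
        linarith
      · linarith

theorem P2.saddle_eq_of_autEquiv {b b' : ℝ} (hb : b = 0 ∨ b = 1) (hb' : b' = 0 ∨ b' = 1)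
    (h : AutEquiv (P2.saddle b) (P2.saddle b')) : P2.saddle b = P2.saddle b' := by
  obtain ⟨c, hc, hbb⟩ := P2.autEquiv_saddle_saddle h
  rcases hb with rfl | rfl <;> rcases hb' with rfl | rfl
  · rfl
  · exact absurd (by simpa using hbb.symm) hc
  · exact absurd hbb (by simp)
  · rfl

theorem AutEquiv.exists_isCrit {f g : P2} (h : AutEquiv f g) (hg : ∃ p : Fin 2 → ℂ, P2.IsCrit g p) :
    ∃ p : Fin 2 → ℂ, P2.IsCrit f p := by
  obtain ⟨c, d, -, -, h⟩ := h.exists_transfer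
  obtain ⟨p, hp⟩ := hg
  obtain ⟨q, -, -, hq, -⟩ := h p hp
  exact ⟨q, hq⟩

theorem P2.not_autEquiv_X_pow_sub_X {g : P2} (hg : ∃ p : Fin 2 → ℂ, P2.IsCrit g p) :
    ¬ AutEquiv (X 0 ^ 3 - X 1) g := fun h =>
  let ⟨p, hp⟩ := h.exists_isCrit hg
  P2.not_isCrit_X_pow_sub_X p hp

theorem FamD.normalForm {f : P2} (hf : FamD f) :
    f = X 0 ^ 3 - X 1 ∨ (∃ b, (b = 0 ∨ b = 1) ∧ f = P2.saddle b) ∨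
      ∃ δ a b : ℝ, (δ = 0 ∨ δ = 1) ∧ (a = 0 ∨ a = 1 ∨ a = -1) ∧
        (a = 0 → b = 0 ∨ b = 1 ∨ b = -1) ∧ (δ = 0 → 0 ≤ b) ∧ f = P2.cubic δ a b := by
  rcases hf with ⟨e, J, he, rfl⟩ | ⟨e, he, rfl⟩ | rfl | rfl | rfl | rfl | ⟨e, J, he, hJ, rfl⟩ |
    rfl | rfl
  · have : e ≠ 0 := by rcases he with rfl | rfl <;> norm_num
    exact .inr <| .inr ⟨1, e, J, .inr rfl, .inr he, by simp [this], by simp, by simp [P2.cubic]⟩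
  · exact .inr <| .inr ⟨1, 0, e, .inr rfl, .inl rfl, by simp [he], by simp, by simp [P2.cubic]⟩
  · exact .inr <| .inr ⟨1, 0, 0, by simp [P2.cubic]⟩
  · exact .inl rfl
  · exact .inr <| .inl ⟨1, by simp [P2.saddle]⟩
  · exact .inr <| .inl ⟨0, by simp [P2.saddle]⟩
  · have : e ≠ 0 := by rcases he with rfl | rfl <;> norm_num
    exact .inr <| .inr ⟨0, e, J, .inl rfl, .inr he, by simp [this], fun _ => hJ,
      by simp [P2.cubic]⟩
  · exact .inr <| .inr ⟨0, 0, 1, by simp [P2.cubic]⟩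
  · exact .inr <| .inr ⟨0, 0, 0, by simp [P2.cubic]⟩

theorem stmt16 (f g : P2) (hf : FamD f) (hg : FamD g) (h : AutEquiv f g) :
    f = g := by
  have hcubic (δ a b : ℝ) : ∃ p : Fin 2 → ℂ, P2.IsCrit (P2.cubic δ a b) p :=
    let ⟨_, _, hp, _⟩ := P2.exists_isCrit_cubic δ a b
    ⟨_, hp⟩
  have hsaddle (b : ℝ) : ∃ p : Fin 2 → ℂ, P2.IsCrit (P2.saddle b) p :=
    ⟨0, (P2.isCrit_saddle_iff b _).mpr ⟨rfl, rfl⟩⟩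
  rcases hf.normalForm with rfl | ⟨b, hb, rfl⟩ | ⟨δ, a, b, hδ, ha, hb, hpos, rfl⟩ <;>
    rcases hg.normalForm with rfl | ⟨b', hb', rfl⟩ | ⟨δ', a', b', hδ', ha', hb', hpos', rfl⟩
  · rfl
  · exact absurd h (P2.not_autEquiv_X_pow_sub_X (hsaddle b'))
  · exact absurd h (P2.not_autEquiv_X_pow_sub_X (hcubic δ' a' b'))
  · exact absurd h.symm (P2.not_autEquiv_X_pow_sub_X (hsaddle b))
  · exact P2.saddle_eq_of_autEquiv hb hb' h
  · exact absurd h (P2.not_autEquiv_saddle_cubic b δ' a' b')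
  · exact absurd h.symm (P2.not_autEquiv_X_pow_sub_X (hcubic δ a b))
  · exact absurd h.symm (P2.not_autEquiv_saddle_cubic b' δ a b)
  · exact P2.cubic_eq_of_autEquiv hδ hδ' ha ha' hb hb' hpos hpos' h
end

section
/- In ℝ[x,y] the following hold: (i) there is a ring automorphism φ of ℝ[x,y] with φ(x) = y and φ(y) = y³ − x, and this φ satisfies φ(x³ − y) = x; (ii) there is a ring automorphism ψ of ℝ[x,y] with ψ(x) = y and ψ(y) = y² − x, and this ψ satisfies ψ(x³ − x·y) = x·y and ψ(x³ − x·y + 1) = x·y + 1. Consequently, AutDeg(x³ − y) ≤ 1 and AutDeg(x³ − x·y) ≤ 2 and AutDeg(x³ − x·y + 1) ≤ 2. -/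
open MvPolynomial

/-- `AutDeg f` : the minimal total degree of a polynomial `g` with `g ≈ f`. -/
noncomputable def AutDeg (f : P2) : ℕ :=
  sInf {n : ℕ | ∃ g : P2, AutEquiv g f ∧ g.totalDegree = n}

/-- The automorphism of `ℝ[x,y]` sending `x` to `y` and `y` to `y ^ n - x`. -/
noncomputable def powShear (n : ℕ) : P2 ≃ₐ[ℝ] P2 :=
  AlgEquiv.ofAlgHom (aeval ![X 1, X 1 ^ n - X 0]) (aeval ![X 0 ^ n - X 1, X 0])
    (by ext i; fin_cases i <;> simp) (by ext i; fin_cases i <;> simp)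

theorem powShear_X_zero (n : ℕ) : powShear n (X 0) = X 1 := by
  simp [powShear]

theorem powShear_X_one (n : ℕ) : powShear n (X 1) = X 1 ^ n - X 0 := by
  simp [powShear]

theorem AutDeg_le_of_map_eq {f g : P2} {d : ℕ} (φ : P2 ≃+* P2) (h : φ f = g)
    (hd : g.totalDegree ≤ d) : AutDeg f ≤ d := by
  refine le_trans (Nat.sInf_le ⟨g, ⟨φ.symm, 1, one_ne_zero, ?_⟩, rfl⟩) hd
  simp [← h]

theorem stmt19 :
    (∃ φ : P2 ≃+* P2, φ (X 0) = X 1 ∧ φ (X 1) = X 1 ^ 3 - X 0 ∧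
      φ (X 0 ^ 3 - X 1) = X 0) ∧
    (∃ ψ : P2 ≃+* P2, ψ (X 0) = X 1 ∧ ψ (X 1) = X 1 ^ 2 - X 0 ∧
      ψ (X 0 ^ 3 - X 0 * X 1) = X 0 * X 1 ∧
      ψ (X 0 ^ 3 - X 0 * X 1 + 1) = X 0 * X 1 + 1) ∧
    AutDeg (X 0 ^ 3 - X 1) ≤ 1 ∧
    AutDeg (X 0 ^ 3 - X 0 * X 1) ≤ 2 ∧
    AutDeg (X 0 ^ 3 - X 0 * X 1 + 1) ≤ 2 := by
  have h₁ : (powShear 3 : P2 ≃+* P2) (X 0 ^ 3 - X 1) = X 0 := by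
    simp [powShear_X_zero, powShear_X_one]
  have h₂ : (powShear 2 : P2 ≃+* P2) (X 0 ^ 3 - X 0 * X 1) = X 0 * X 1 := by
    simp only [AlgEquiv.coe_ringEquiv, map_sub, map_mul, map_pow, powShear_X_zero, powShear_X_one]
    ring
  have h₃ : (powShear 2 : P2 ≃+* P2) (X 0 ^ 3 - X 0 * X 1 + 1) = X 0 * X 1 + 1 := by
    rw [map_add, h₂, map_one]
  have hd : (X 0 * X 1 : P2).totalDegree ≤ 2 :=
    (totalDegree_mul _ _).trans (by simp [totalDegree_X])
  refine ⟨⟨_, powShear_X_zero 3, powShear_X_one 3, h₁⟩,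
    ⟨_, powShear_X_zero 2, powShear_X_one 2, h₂, h₃⟩,
    AutDeg_le_of_map_eq _ h₁ (totalDegree_X _).le, AutDeg_le_of_map_eq _ h₂ hd,
    AutDeg_le_of_map_eq _ h₃ ((totalDegree_add _ _).trans (max_le hd (by simp)))⟩
end
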